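/- Let k0>0, 0<r_s<r_M, and let f:ℝ³→ℂ be continuous with support contained in the open ball B_{r_s} of radius r_s centered at the origin. Let u(x) = ∫_{ℝ³} e^{i k0 ‖x−y‖}/(4π‖x−y‖) · e^{i k0 y3} f(y) dy be the outgoing Born approximation of the wave scattered from f under the incident plane wave e^{i k0 r3}. Then for all (r1,r2)∈ℝ², u(r1,r2,r_M) = (i/(2√(2π))) ∫_{ℝ²} κ(k1,k2)^{−1} e^{i(k1r1 + k2r2 + κ(k1,k2)·r_M)} 𝓕f(k1,k2,κ(k1,k2)−k0) d(k1,k2), where 𝓕f(k1,k2,w) = (2π)^{−3/2}∫_{ℝ³} f(x)e^{−i(k1x1+k2x2+wx3)}dx (well defined for complex w since f is compactly supported), and the integrand is absolutely integrable over ℝ². -/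

import Mathlib

open MeasureTheory

noncomputable section

/-- κ(k1,k2) = √(k0²−k1²−k2²) for k1²+k2² ≤ k0², and i√(k1²+k2²−k0²) otherwise. -/
def kappaC (k0 k1 k2 : ℝ) : ℂ :=
  if k1 ^ 2 + k2 ^ 2 ≤ k0 ^ 2 then ((Real.sqrt (k0 ^ 2 - k1 ^ 2 - k2 ^ 2) : ℝ) : ℂ)
  else Complex.I * ((Real.sqrt (k1 ^ 2 + k2 ^ 2 - k0 ^ 2) : ℝ) : ℂ)

/-- The 3D Fourier transform 𝓕f(k1,k2,w) = (2π)^{−3/2} ∫ f(x) e^{−i(k1x1+k2x2+wx3)} dx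
with possibly complex third frequency `w`. -/
def FT3c (f : ℝ × ℝ × ℝ → ℂ) (k1 k2 : ℝ) (w : ℂ) : ℂ :=
  (((2 * Real.pi) ^ (-(3 : ℝ) / 2) : ℝ) : ℂ) *
    ∫ x : ℝ × ℝ × ℝ, f x *
      Complex.exp (-Complex.I * ((k1 : ℂ) * (x.1 : ℂ) + (k2 : ℂ) * (x.2.1 : ℂ) + w * (x.2.2 : ℂ)))

/-- The outgoing Born approximation u = G ∗ (u^inc f) for the incident plane wave
u^inc(y) = e^{i k0 y3}. -/
def uBorn (k0 : ℝ) (f : ℝ × ℝ × ℝ → ℂ) (x : ℝ × ℝ × ℝ) : ℂ :=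
  ∫ y : ℝ × ℝ × ℝ,
    Complex.exp (Complex.I * (k0 : ℂ) *
        ((Real.sqrt ((x.1 - y.1) ^ 2 + (x.2.1 - y.2.1) ^ 2 + (x.2.2 - y.2.2) ^ 2) : ℝ) : ℂ)) /
      (4 * (Real.pi : ℂ) *
        ((Real.sqrt ((x.1 - y.1) ^ 2 + (x.2.1 - y.2.1) ^ 2 + (x.2.2 - y.2.2) ^ 2) : ℝ) : ℂ)) *
      (Complex.exp (Complex.I * ((k0 * y.2.2 : ℝ) : ℂ)) * f y)

section

open Set Real

theorem integral_cauchy_schlomilch {s z : ℝ} (hs : 0 < s) (hz : 0 < z) :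
    IntegrableOn (fun u : ℝ => s * rexp (-(s * u - z / (2 * u)) ^ 2)) (Ioi 0) ∧
    IntegrableOn (fun u : ℝ => z / (2 * u ^ 2) * rexp (-(s * u - z / (2 * u)) ^ 2)) (Ioi 0) ∧
    ∫ u in Ioi (0 : ℝ), s * rexp (-(s * u - z / (2 * u)) ^ 2) = √π / 2 ∧
    ∫ u in Ioi (0 : ℝ), z / (2 * u ^ 2) * rexp (-(s * u - z / (2 * u)) ^ 2) = √π / 2 := by
  set φ : ℝ → ℝ := fun u => s * u - z / (2 * u) with hφ
  have hφd : ∀ u ∈ Ioi (0 : ℝ), HasDerivWithinAt φ (s + z / (2 * u ^ 2)) (Ioi 0) u := by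
    intro u hu
    have hu' : (0 : ℝ) < u := hu
    have h1 : HasDerivAt (fun u : ℝ => s * u - z / 2 * u⁻¹) (s * 1 - z / 2 * (-(u ^ 2)⁻¹)) u :=
      ((hasDerivAt_id u).const_mul s).sub ((hasDerivAt_inv hu'.ne').const_mul (z / 2))
    refine (h1.congr_deriv ?_).hasDerivWithinAt.congr_of_mem ?_ hu
    · field_simp
      ring
    · intro x _
      simp only [hφ]
      ring
  have hpos : ∀ u ∈ Ioi (0 : ℝ), 0 < s + z / (2 * u ^ 2) := by
    intro u hu
    have hu' : (0 : ℝ) < u := hu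
    positivity
  have hinj : InjOn φ (Ioi 0) := by
    intro u hu v hv h
    have hu' : (0 : ℝ) < u := hu
    have hv' : (0 : ℝ) < v := hv
    simp only [hφ] at h
    have : (u - v) * (s + z / (2 * u * v)) = 0 := by
      field_simp
      field_simp at h
      linarith
    rcases mul_eq_zero.1 this with h | h
    · linarith
    · have : 0 < s + z / (2 * u * v) := by positivity
      linarith
  have himg : φ '' Ioi 0 = univ := by
    refine eq_univ_of_forall fun v => ?_
    have hlt : |v| < √(v ^ 2 + 2 * s * z) := by
      rw [← Real.sqrt_sq_eq_abs]
      exact Real.sqrt_lt_sqrt (sq_nonneg v) (by nlinarith [mul_pos hs hz])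
    have hsq : √(v ^ 2 + 2 * s * z) ^ 2 = v ^ 2 + 2 * s * z := Real.sq_sqrt (by positivity)
    have hv : 0 < v + √(v ^ 2 + 2 * s * z) := by linarith [neg_abs_le v]
    refine ⟨(v + √(v ^ 2 + 2 * s * z)) / (2 * s), by simp only [mem_Ioi]; positivity, ?_⟩
    simp only [hφ]
    generalize √(v ^ 2 + 2 * s * z) = w at *
    field_simp
    nlinarith
  have hgauss : Integrable fun x : ℝ => rexp (-x ^ 2) := by
    simpa using integrable_exp_neg_mul_sq (b := 1) one_pos
  have hI : IntegrableOn (fun u : ℝ => (s + z / (2 * u ^ 2)) * rexp (-φ u ^ 2)) (Ioi 0) := by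
    have := (integrableOn_image_iff_integrableOn_abs_deriv_smul measurableSet_Ioi hφd hinj
      (fun x : ℝ => rexp (-x ^ 2))).1 (by rw [himg]; exact hgauss.integrableOn)
    refine this.congr_fun (fun u hu => ?_) measurableSet_Ioi
    simp [abs_of_pos (hpos u hu)]
  have hS : ∫ u in Ioi (0 : ℝ), (s + z / (2 * u ^ 2)) * rexp (-φ u ^ 2) = √π := by
    have := integral_image_eq_integral_abs_deriv_smul measurableSet_Ioi hφd hinj
      (fun x : ℝ => rexp (-x ^ 2))
    rw [himg, setIntegral_univ] at this
    have h2 : ∫ x : ℝ, rexp (-x ^ 2) = √π := by simpa using integral_gaussian 1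
    rw [← h2, this]
    refine setIntegral_congr_fun measurableSet_Ioi (fun u hu => ?_)
    simp [abs_of_pos (hpos u hu)]
  have hmeas : Measurable φ := by fun_prop
  have hA : IntegrableOn (fun u : ℝ => s * rexp (-φ u ^ 2)) (Ioi 0) := by
    refine Integrable.mono' hI (by fun_prop) ?_
    filter_upwards [ae_restrict_mem measurableSet_Ioi] with u hu
    have hu' : (0 : ℝ) < u := hu
    rw [Real.norm_of_nonneg (by positivity)]
    gcongr
    have : 0 < z / (2 * u ^ 2) := by positivity
    linarith
  have hB : IntegrableOn (fun u : ℝ => z / (2 * u ^ 2) * rexp (-φ u ^ 2)) (Ioi 0) := by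
    refine (hI.sub hA).congr (.of_forall fun u => ?_)
    simp only [Pi.sub_apply]
    ring
  have hAB : ∫ u in Ioi (0 : ℝ), s * rexp (-φ u ^ 2) =
      ∫ u in Ioi (0 : ℝ), z / (2 * u ^ 2) * rexp (-φ u ^ 2) := by
    set ψ : ℝ → ℝ := fun u => z / (2 * s) * u⁻¹ with hψ
    have hψd : ∀ u ∈ Ioi (0 : ℝ),
        HasDerivWithinAt ψ (z / (2 * s) * (-(u ^ 2)⁻¹)) (Ioi 0) u := fun u hu =>
      ((hasDerivAt_inv (ne_of_gt hu)).const_mul _).hasDerivWithinAt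
    have hc : z / (2 * s) ≠ 0 := by positivity
    have hψi : InjOn ψ (Ioi 0) := by
      intro u hu v hv h
      exact inv_injective (mul_left_cancel₀ hc h)
    have hψm : ψ '' Ioi 0 = Ioi 0 := by
      ext v
      constructor
      · rintro ⟨u, hu, rfl⟩
        have hu' : (0 : ℝ) < u := hu
        simp only [hψ, mem_Ioi]
        positivity
      · intro hv
        have hv' : (0 : ℝ) < v := hv
        refine ⟨z / (2 * s) * v⁻¹, by simp only [mem_Ioi]; positivity, ?_⟩
        simp only [hψ]
        field_simp
    have := integral_image_eq_integral_abs_deriv_smul measurableSet_Ioi hψd hψi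
      (fun u : ℝ => s * rexp (-φ u ^ 2))
    rw [hψm] at this
    rw [this]
    refine setIntegral_congr_fun measurableSet_Ioi (fun u hu => ?_)
    have hu' : (0 : ℝ) < u := hu
    have h1 : φ (ψ u) = - φ u := by
      simp only [hφ, hψ]
      field_simp
      ring
    have h2 : |z / (2 * s) * (-(u ^ 2)⁻¹)| = z / (2 * s) * (u ^ 2)⁻¹ := by
      rw [mul_neg, abs_neg, abs_of_pos (by positivity)]
    simp only [h1, h2, smul_eq_mul, neg_sq]
    field_simp
  have hsum : (∫ u in Ioi (0 : ℝ), s * rexp (-φ u ^ 2)) +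
      ∫ u in Ioi (0 : ℝ), z / (2 * u ^ 2) * rexp (-φ u ^ 2) = √π := by
    rw [← integral_add hA hB, ← hS]
    congr 1
    ext u
    ring
  exact ⟨hA, hB, by linarith, by linarith⟩

theorem integrable_radial_prod {f : ℝ → ℝ} (hf : IntegrableOn (fun r => r * f r) (Ioi 0)) :
    Integrable fun p : ℝ × ℝ => f (√(p.1 ^ 2 + p.2 ^ 2)) := by
  have h : Integrable (fun w : ℂ => f ‖w‖) := by
    rw [integrable_fun_norm_addHaar volume]
    simpa using hf
  rw [← Complex.volume_preserving_equiv_real_prod.integrable_comp_emb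
    Complex.measurableEquivRealProd.measurableEmbedding]
  refine h.congr (.of_forall fun w => ?_)
  simp [Complex.norm_eq_sqrt_sq_add_sq, Complex.measurableEquivRealProd_apply]

theorem integrable_exp_neg_radial {z : ℝ} (hz : 0 < z) :
    Integrable fun p : ℝ × ℝ => rexp (-(z * √(p.1 ^ 2 + p.2 ^ 2))) := by
  refine integrable_radial_prod (f := fun r => rexp (-(z * r))) ?_
  have := integrableOn_rpow_mul_exp_neg_mul_rpow (p := 1) (s := 1) (b := z)
    (by norm_num) one_pos hz
  simpa using this

theorem integrable_exp_neg_radial_div_sqrt {z k : ℝ} (hz : 0 < z) (hk : 0 < k) :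
    Integrable fun p : ℝ × ℝ => rexp (-(z * √(p.1 ^ 2 + p.2 ^ 2))) /
      √|p.1 ^ 2 + p.2 ^ 2 - k ^ 2| := by
  have key : IntegrableOn (fun r => r * (rexp (-(z * r)) / √|r ^ 2 - k ^ 2|)) (Ioi 0) := by
    have h1 : IntegrableOn (fun r => r * rexp (-(z * r))) (Ioi 0) := by
      have := integrableOn_rpow_mul_exp_neg_mul_rpow (p := 1) (s := 1) (b := z)
        (by norm_num) one_pos hz
      simpa using this
    have h2 : Integrable (fun t : ℝ => (Metric.ball (0 : ℝ) 1).indicator (fun t => (√|t|)⁻¹) t) := by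
      rw [integrable_indicator_iff measurableSet_ball]
      have := (integrableOn_fun_norm_addHaar (E := ℝ) (μ := volume) (f := fun t : ℝ => (√t)⁻¹) (r := 1)).2 ?_
      · simpa using this
      · have := (intervalIntegral.intervalIntegrable_rpow' (a := 0) (b := 1) (r := -1/2) (by norm_num))
        rw [intervalIntegrable_iff_integrableOn_Ioo_of_le zero_le_one] at this
        refine this.congr_fun (fun t ht => ?_) measurableSet_Ioo
        simp [Real.sqrt_eq_rpow, ← Real.rpow_neg ht.1.le]
        norm_num
    have h3 := ((h1.add ((h2.comp_sub_right k).integrableOn.const_mul (k + 1))).const_mul (√k)⁻¹)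
    refine Integrable.mono' h3 (by fun_prop) ?_
    filter_upwards [ae_restrict_mem measurableSet_Ioi] with r hr
    have hr : 0 < r := hr
    rw [Real.norm_of_nonneg (by positivity)]
    have e1 : √|r ^ 2 - k ^ 2| = √(r + k) * √|r - k| := by
      rw [show r ^ 2 - k ^ 2 = (r + k) * (r - k) by ring, abs_mul,
        abs_of_pos (by positivity : 0 < r + k), Real.sqrt_mul (by positivity)]
    have e2 : (√(r + k))⁻¹ ≤ (√k)⁻¹ := by
      gcongr
      linarith
    have e3 : rexp (-(z * r)) ≤ 1 := Real.exp_le_one_iff.2 (by nlinarith)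
    have e4 : r * rexp (-(z * r)) * (√|r - k|)⁻¹ ≤ r * rexp (-(z * r)) + (k + 1) *
        (Metric.ball (0 : ℝ) 1).indicator (fun t => (√|t|)⁻¹) (r - k) := by
      by_cases h : |r - k| < 1
      · rw [indicator_of_mem (by simpa using h)]
        have : r * rexp (-(z * r)) ≤ k + 1 := by
          have := (abs_lt.1 h).2
          nlinarith [Real.exp_pos (-(z * r))]
        have := mul_le_mul_of_nonneg_right this (by positivity : 0 ≤ (√|r - k|)⁻¹)
        have : 0 ≤ r * rexp (-(z * r)) := by positivity
        linarith
      · rw [indicator_of_notMem (by simpa using h), mul_zero, add_zero]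
        refine mul_le_of_le_one_right (by positivity) (inv_le_one_of_one_le₀ ?_)
        rw [Real.one_le_sqrt]
        exact not_lt.1 h
    calc r * (rexp (-(z * r)) / √|r ^ 2 - k ^ 2|)
        = (√(r + k))⁻¹ * (r * rexp (-(z * r)) * (√|r - k|)⁻¹) := by
          rw [e1, div_eq_mul_inv, mul_inv]; ring
      _ ≤ (√k)⁻¹ * (r * rexp (-(z * r)) + (k + 1) *
        (Metric.ball (0 : ℝ) 1).indicator (fun t => (√|t|)⁻¹) (r - k)) := by gcongr
  refine (integrable_radial_prod key).congr (.of_forall fun p => ?_)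
  simp only []
  rw [Real.sq_sqrt (by positivity)]

theorem ae_sq_add_sq_ne (c : ℝ) : ∀ᵐ p : ℝ × ℝ, p.1 ^ 2 + p.2 ^ 2 ≠ c := by
  have hm : MeasurableSet {p : ℝ × ℝ | p.1 ^ 2 + p.2 ^ 2 = c} :=
    measurableSet_eq_fun (by fun_prop) (by fun_prop)
  rw [ae_iff]
  simp only [ne_eq, not_not]
  rw [Measure.volume_eq_prod, Measure.measure_prod_null hm]
  refine .of_forall fun x => ?_
  refine Set.Finite.measure_zero (Set.Finite.subset (Set.toFinite {√(c - x ^ 2), -√(c - x ^ 2)}) ?_) _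
  intro y hy
  have hy : x ^ 2 + y ^ 2 = c := hy
  have h : c - x ^ 2 = y ^ 2 := by linarith
  rw [h, Real.sqrt_sq_eq_abs]
  rcases abs_choice y with h | h <;> simp [h]

theorem exp_neg_sq_add_eq {s z u : ℝ} (hu : 0 < u) :
    rexp (-(s ^ 2 * u ^ 2) - z ^ 2 / (4 * u ^ 2)) =
      rexp (-(s * z)) * rexp (-(s * u - z / (2 * u)) ^ 2) := by
  rw [← Real.exp_add]
  congr 1
  field_simp
  ring

theorem integrableOn_exp_neg_sq_add {s z : ℝ} (hs : 0 < s) (hz : 0 < z) :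
    IntegrableOn (fun u : ℝ => rexp (-(s ^ 2 * u ^ 2) - z ^ 2 / (4 * u ^ 2))) (Ioi 0) := by
  refine IntegrableOn.congr_fun ((integral_cauchy_schlomilch hs hz).1.const_mul (rexp (-(s * z)) / s))
    (fun u hu => ?_) measurableSet_Ioi
  rw [exp_neg_sq_add_eq hu]
  field_simp

theorem integral_exp_neg_sq_add {s z : ℝ} (hs : 0 < s) (hz : 0 < z) :
    ∫ u in Ioi (0 : ℝ), rexp (-(s ^ 2 * u ^ 2) - z ^ 2 / (4 * u ^ 2)) =
      √π / 2 * (rexp (-(s * z)) / s) := by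
  rw [← (integral_cauchy_schlomilch hs hz).2.2.1, mul_comm, ← integral_const_mul]
  refine setIntegral_congr_fun measurableSet_Ioi fun u hu => ?_
  rw [exp_neg_sq_add_eq hu]
  field_simp

theorem integral_inv_sq_mul_exp_neg_sq_add {s z : ℝ} (hs : 0 < s) (hz : 0 < z) :
    ∫ u in Ioi (0 : ℝ), (u ^ 2)⁻¹ * rexp (-(s ^ 2 * u ^ 2) - z ^ 2 / (4 * u ^ 2)) =
      √π * (rexp (-(s * z)) / z) := by
  have h : √π * (rexp (-(s * z)) / z) = 2 * (rexp (-(s * z)) / z) * (√π / 2) := by ring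
  rw [h, ← (integral_cauchy_schlomilch hs hz).2.2.2, ← integral_const_mul]
  refine setIntegral_congr_fun measurableSet_Ioi fun u hu => ?_
  have hu' : (0 : ℝ) < u := hu
  rw [exp_neg_sq_add_eq hu]
  field_simp

theorem integral_cexp_mul_gaussian_prod {b : ℝ} (hb : 0 < b) (x y : ℝ) :
    ∫ p : ℝ × ℝ, Complex.exp (Complex.I * ((p.1 * x + p.2 * y : ℝ) : ℂ)) *
      ((rexp (-(b * (p.1 ^ 2 + p.2 ^ 2))) : ℝ) : ℂ) =
      ((π / b * rexp (-((x ^ 2 + y ^ 2) / (4 * b))) : ℝ) : ℂ) := by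
  have h1 : ∀ t : ℝ, ∫ v : ℝ, Complex.exp (Complex.I * t * v) * Complex.exp (-(b : ℂ) * v ^ 2) =
      ((√(π / b) * rexp (-(t ^ 2 / (4 * b))) : ℝ) : ℂ) := by
    intro t
    rw [fourierIntegral_gaussian (by simpa using hb), Real.sqrt_eq_rpow, Complex.ofReal_mul,
      Complex.ofReal_cpow (by positivity)]
    push_cast
    congr 2
    ring
  have h2 := integral_prod_mul (μ := (volume : Measure ℝ)) (ν := (volume : Measure ℝ))
    (fun v : ℝ => Complex.exp (Complex.I * x * v) * Complex.exp (-(b : ℂ) * v ^ 2))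
    (fun v : ℝ => Complex.exp (Complex.I * y * v) * Complex.exp (-(b : ℂ) * v ^ 2))
  rw [h1, h1] at h2
  have h3 : π / b * rexp (-((x ^ 2 + y ^ 2) / (4 * b))) =
      (√(π / b) * rexp (-(x ^ 2 / (4 * b)))) * (√(π / b) * rexp (-(y ^ 2 / (4 * b)))) := by
    rw [mul_mul_mul_comm, Real.mul_self_sqrt (by positivity), ← Real.exp_add]
    ring_nf
  rw [h3, Complex.ofReal_mul, ← h2, Measure.volume_eq_prod]
  congr 1
  ext p
  push_cast
  simp only [← Complex.exp_add]
  ring_nf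

/-- Weyl's expansion for the Yukawa kernel. -/
theorem weyl_real {a z : ℝ} (ha : 0 < a) (hz : 0 < z) (x y : ℝ) :
    ∫ p : ℝ × ℝ, Complex.exp (Complex.I * ((p.1 * x + p.2 * y : ℝ) : ℂ)) *
      ((rexp (-(√(p.1 ^ 2 + p.2 ^ 2 + a ^ 2) * z)) / √(p.1 ^ 2 + p.2 ^ 2 + a ^ 2) : ℝ) : ℂ) =
      ((2 * π * (rexp (-(a * √(x ^ 2 + y ^ 2 + z ^ 2))) / √(x ^ 2 + y ^ 2 + z ^ 2)) : ℝ) : ℂ) := by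
  set S : ℝ × ℝ → ℝ := fun p => √(p.1 ^ 2 + p.2 ^ 2 + a ^ 2) with hS
  have hSpos : ∀ p, 0 < S p := fun p => Real.sqrt_pos.2 (by positivity)
  have hSsq : ∀ p, S p ^ 2 = p.1 ^ 2 + p.2 ^ 2 + a ^ 2 := fun p => Real.sq_sqrt (by positivity)
  have hSm : Measurable S := by fun_prop
  set r := √(x ^ 2 + y ^ 2 + z ^ 2) with hr
  have hrpos : 0 < r := Real.sqrt_pos.2 (by positivity)
  have hrsq : r ^ 2 = x ^ 2 + y ^ 2 + z ^ 2 := Real.sq_sqrt (by positivity)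
  set K : (ℝ × ℝ) → ℝ → ℝ := fun p u => rexp (-(S p ^ 2 * u ^ 2) - z ^ 2 / (4 * u ^ 2)) with hK
  set E : (ℝ × ℝ) → ℂ := fun p => Complex.exp (Complex.I * ((p.1 * x + p.2 * y : ℝ) : ℂ)) with hE
  have hEn : ∀ p, ‖E p‖ = 1 := fun p => by
    rw [hE]; simp only []; rw [mul_comm, Complex.norm_exp_ofReal_mul_I]
  have hEm : Measurable E := by fun_prop
  have hint : Integrable (Function.uncurry fun p u => E p * ((K p u : ℝ) : ℂ))
      ((volume : Measure (ℝ × ℝ)).prod (volume.restrict (Ioi 0))) := by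
    have hm : Measurable (Function.uncurry fun p u => E p * ((K p u : ℝ) : ℂ)) := by
      simp only [Function.uncurry_def, hK]
      fun_prop
    refine (integrable_prod_iff hm.aestronglyMeasurable).2 ⟨.of_forall fun p => ?_, ?_⟩
    · exact ((integrableOn_exp_neg_sq_add (hSpos p) hz).ofReal).const_mul (E p)
    · have h1 : ∀ p : ℝ × ℝ, ∫ u in Ioi (0 : ℝ), ‖Function.uncurry
          (fun p u => E p * ((K p u : ℝ) : ℂ)) (p, u)‖ = √π / 2 * (rexp (-(S p * z)) / S p) := by
        intro p
        rw [← integral_exp_neg_sq_add (hSpos p) hz]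
        refine integral_congr_ae (.of_forall fun u => ?_)
        simp only [Function.uncurry_apply_pair]
        rw [norm_mul, hEn, one_mul, Complex.norm_real, Real.norm_of_nonneg (Real.exp_nonneg _)]
      simp only [h1]
      refine Integrable.const_mul ?_ _
      refine Integrable.mono' ((integrable_exp_neg_radial hz).const_mul a⁻¹)
        (Measurable.div (by fun_prop) hSm).aestronglyMeasurable (.of_forall fun p => ?_)
      have h2 : a ≤ S p := Real.le_sqrt_of_sq_le (by nlinarith [sq_nonneg p.1, sq_nonneg p.2])
      have h3 : √(p.1 ^ 2 + p.2 ^ 2) ≤ S p := Real.sqrt_le_sqrt (by nlinarith)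
      rw [Real.norm_of_nonneg (by have := hSpos p; positivity), div_eq_inv_mul]
      gcongr ?_ * rexp ?_
      · gcongr
      · nlinarith
  have hswap := integral_integral_swap hint
  have hL : ∀ p, ∫ u in Ioi (0 : ℝ), E p * ((K p u : ℝ) : ℂ) =
      ((√π / 2 : ℝ) : ℂ) * (E p * ((rexp (-(S p * z)) / S p : ℝ) : ℂ)) := by
    intro p
    rw [integral_const_mul, integral_complex_ofReal, integral_exp_neg_sq_add (hSpos p) hz]
    push_cast
    ring
  have hR : ∫ u in Ioi (0 : ℝ), ∫ p, E p * ((K p u : ℝ) : ℂ) =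
      ((π * (√π * (rexp (-(a * r)) / r)) : ℝ) : ℂ) := by
    rw [← integral_inv_sq_mul_exp_neg_sq_add ha hrpos, ← integral_const_mul, ← integral_complex_ofReal]
    refine setIntegral_congr_fun measurableSet_Ioi fun u hu => ?_
    have hu' : (0 : ℝ) < u := hu
    have h1 : ∀ p, E p * ((K p u : ℝ) : ℂ) =
        ((rexp (-(a ^ 2 * u ^ 2) - z ^ 2 / (4 * u ^ 2)) : ℝ) : ℂ) *
        (E p * ((rexp (-(u ^ 2 * (p.1 ^ 2 + p.2 ^ 2))) : ℝ) : ℂ)) := by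
      intro p
      rw [mul_left_comm, ← Complex.ofReal_mul, ← Real.exp_add]
      simp only [hK, hSsq]
      ring_nf
    simp only [h1]
    rw [integral_const_mul, hE, integral_cexp_mul_gaussian_prod (by positivity), ← Complex.ofReal_mul]
    congr 1
    rw [mul_left_comm, ← Real.exp_add, hrsq, div_eq_mul_inv π, mul_assoc]
    congr 3
    field_simp
    ring
  simp only [hL] at hswap
  rw [integral_const_mul, hR] at hswap
  have hpi : ((√π / 2 : ℝ) : ℂ) ≠ 0 := by
    exact_mod_cast (by positivity : √π / 2 ≠ 0)
  refine mul_left_cancel₀ hpi (hswap.trans ?_)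
  push_cast
  ring

theorem Complex.sqrt_sq (w : ℂ) : w.sqrt ^ 2 = w := Complex.cpow_ofNat_inv_pow w 2

theorem Complex.norm_sqrt (w : ℂ) : ‖w.sqrt‖ = √‖w‖ := by
  conv_rhs => rw [← Complex.sqrt_sq w, norm_pow, Real.sqrt_sq (norm_nonneg _)]

theorem Complex.measurable_sqrt : Measurable Complex.sqrt := by
  unfold Complex.sqrt
  fun_prop

theorem Complex.sub_sqrt_norm_le_re_sqrt {t : ℝ} (l : ℂ) :
    √t - √‖l‖ ≤ ((t : ℂ) + l).sqrt.re := by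
  rw [Complex.sqrt, Complex.cpow_inv_two_re, sub_le_iff_le_add]
  rcases le_total t 0 with ht | ht
  · rw [Real.sqrt_eq_zero'.2 ht]
    positivity
  · set w := (t : ℂ) + l
    have h1 : t ≤ w.re + ‖l‖ := by
      have := (abs_le.1 (Complex.abs_re_le_norm l)).1
      simp only [w, Complex.add_re, Complex.ofReal_re]
      linarith
    have h2 : w.re ≤ (‖w‖ + w.re) / 2 := by linarith [Complex.re_le_norm w]
    have h3 : 0 ≤ (‖w‖ + w.re) / 2 := by
      linarith [(abs_le.1 (Complex.abs_re_le_norm w)).1]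
    refine Real.sqrt_le_iff.2 ⟨by positivity, ?_⟩
    nlinarith [Real.sq_sqrt h3, Real.sq_sqrt (norm_nonneg l),
      mul_nonneg (Real.sqrt_nonneg ((‖w‖ + w.re) / 2)) (Real.sqrt_nonneg ‖l‖)]

/-- The spectral kernel of the Helmholtz half-space propagator, as a function of the
spectral parameter `w`. -/
def decayKernel (z : ℝ) (w : ℂ) : ℂ := Complex.exp (-(w.sqrt * z)) / w.sqrt

theorem norm_exp_neg_sqrt_le {z : ℝ} (hz : 0 ≤ z) (t : ℝ) (l : ℂ) :
    ‖Complex.exp (-(((t : ℂ) + l).sqrt * z))‖ ≤ rexp (√‖l‖ * z) * rexp (-(z * √t)) := by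
  rw [Complex.norm_exp, ← Real.exp_add, Real.exp_le_exp]
  have := mul_le_mul_of_nonneg_right (Complex.sub_sqrt_norm_le_re_sqrt (t := t) l) hz
  simp only [Complex.neg_re, Complex.re_mul_ofReal]
  linarith

theorem norm_decayKernel_le {z : ℝ} (hz : 0 ≤ z) (t : ℝ) (l : ℂ) :
    ‖decayKernel z ((t : ℂ) + l)‖ ≤
      rexp (√‖l‖ * z) * rexp (-(z * √t)) / √‖(t : ℂ) + l‖ := by
  rw [decayKernel, norm_div, Complex.norm_sqrt]
  gcongr
  exact norm_exp_neg_sqrt_le hz t l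

theorem hasDerivAt_decayKernel (z : ℝ) {w : ℂ} (hw : w ∈ Complex.slitPlane) :
    HasDerivAt (decayKernel z)
      (Complex.exp (-(w.sqrt * z)) * (-(z / (2 * w)) - 1 / (2 * w * w.sqrt))) w := by
  have hw0 : w ≠ 0 := Complex.slitPlane_ne_zero hw
  have hs0 : w.sqrt ≠ 0 := fun h => hw0 (by rw [← Complex.sqrt_sq w, h]; simp)
  have hs : HasDerivAt Complex.sqrt (1 / (2 * w.sqrt)) w := by
    refine (Complex.hasDerivAt_sqrt hw).congr_deriv ?_
    rw [Complex.sqrt, show (-1 / 2 : ℂ) = -2⁻¹ by norm_num, Complex.cpow_neg]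
    field_simp
  refine (((hs.mul_const (z : ℂ)).neg.cexp).div hs hs0).congr_deriv ?_
  have h2 := Complex.sqrt_sq w
  simp only [Pi.neg_apply]
  generalize w.sqrt = s at *
  subst h2
  field_simp

theorem norm_deriv_decayKernel_le {z c : ℝ} (hz : 0 ≤ z) (hc : 0 < c) (t : ℝ) (l : ℂ)
    (h : c ≤ ‖(t : ℂ) + l‖) :
    ‖Complex.exp (-(((t : ℂ) + l).sqrt * z)) *
      (-(z / (2 * ((t : ℂ) + l))) - 1 / (2 * ((t : ℂ) + l) * ((t : ℂ) + l).sqrt))‖ ≤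
    rexp (√‖l‖ * z) * rexp (-(z * √t)) * (z / (2 * c) + 1 / (2 * c * √c)) := by
  rw [norm_mul]
  refine mul_le_mul (norm_exp_neg_sqrt_le hz t l) ?_ (norm_nonneg _) (by positivity)
  refine (norm_sub_le _ _).trans ?_
  rw [norm_neg, norm_div, norm_div, norm_mul, norm_mul, norm_mul, Complex.norm_sqrt,
    Complex.norm_real, Real.norm_of_nonneg hz, norm_one, Complex.norm_ofNat]
  gcongr

theorem exists_le_norm_ofReal_add {l : ℂ} (hl : l ∈ Complex.slitPlane) :
    ∃ c > 0, ∀ m ∈ Metric.ball l c, m ∈ Complex.slitPlane ∧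
      ∀ t : ℝ, 0 ≤ t → c ≤ ‖(t : ℂ) + m‖ := by
  obtain ⟨d, hd, hball⟩ := Metric.isOpen_iff.1 Complex.isOpen_slitPlane l hl
  refine ⟨d / 2, by positivity, fun m hm => ⟨hball (Metric.ball_subset_ball (by linarith) hm),
    fun t ht => ?_⟩⟩
  have h1 : d ≤ dist (-(t : ℂ)) l := by
    by_contra! h
    have := hball (Metric.mem_ball.2 h)
    rw [Complex.mem_slitPlane_iff] at this
    simp at this
    linarith
  have h2 := dist_triangle (-(t : ℂ)) m l
  rw [Metric.mem_ball] at hm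
  have h3 : dist (-(t : ℂ)) m = ‖(t : ℂ) + m‖ := by
    rw [dist_eq_norm, ← norm_neg]
    ring_nf
  linarith

theorem add_mem_slitPlane {t : ℝ} (ht : 0 ≤ t) {l : ℂ} (hl : l ∈ Complex.slitPlane) :
    (t : ℂ) + l ∈ Complex.slitPlane := by
  rw [Complex.mem_slitPlane_iff] at *
  simp only [Complex.add_re, Complex.ofReal_re, Complex.add_im, Complex.ofReal_im, zero_add]
  rcases hl with h | h
  · left; linarith
  · right; exact h

theorem norm_cexp_I_mul_ofReal (t : ℝ) : ‖Complex.exp (Complex.I * t)‖ = 1 := by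
  rw [mul_comm, Complex.norm_exp_ofReal_mul_I]

theorem measurable_decayKernel (z : ℝ) : Measurable (decayKernel z) := by
  have := Complex.measurable_sqrt
  unfold decayKernel
  fun_prop

theorem measurable_decayKernel_comp (z x y : ℝ) (l : ℂ) :
    Measurable fun p : ℝ × ℝ => Complex.exp (Complex.I * ((p.1 * x + p.2 * y : ℝ) : ℂ)) *
      decayKernel z (((p.1 ^ 2 + p.2 ^ 2 : ℝ) : ℂ) + l) := by
  have := measurable_decayKernel z
  fun_prop

theorem differentiableAt_integral_decayKernel {z : ℝ} (hz : 0 < z) (x y : ℝ) {l : ℂ}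
    (hl : l ∈ Complex.slitPlane) :
    DifferentiableAt ℂ (fun l : ℂ => ∫ p : ℝ × ℝ,
      Complex.exp (Complex.I * ((p.1 * x + p.2 * y : ℝ) : ℂ)) *
      decayKernel z (((p.1 ^ 2 + p.2 ^ 2 : ℝ) : ℂ) + l)) l := by
  obtain ⟨c, hc, hball⟩ := exists_le_norm_ofReal_add hl
  have hq : ∀ p : ℝ × ℝ, 0 ≤ p.1 ^ 2 + p.2 ^ 2 := fun p => by positivity
  have hsm := Complex.measurable_sqrt
  have hM : ∀ m ∈ Metric.ball l c, ‖m‖ ≤ ‖l‖ + c := fun m hm => by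
    have h1 := norm_sub_norm_le m l
    rw [Metric.mem_ball, dist_eq_norm] at hm
    linarith
  have hl' := Metric.mem_ball_self (x := l) hc
  refine (hasDerivAt_integral_of_dominated_loc_of_deriv_le (μ := (volume : Measure (ℝ × ℝ)))
    (F' := fun (m : ℂ) (p : ℝ × ℝ) => Complex.exp (Complex.I * ((p.1 * x + p.2 * y : ℝ) : ℂ)) *
      (Complex.exp (-((((p.1 ^ 2 + p.2 ^ 2 : ℝ) : ℂ) + m).sqrt * z)) *
      (-(z / (2 * (((p.1 ^ 2 + p.2 ^ 2 : ℝ) : ℂ) + m))) -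
        1 / (2 * (((p.1 ^ 2 + p.2 ^ 2 : ℝ) : ℂ) + m) * (((p.1 ^ 2 + p.2 ^ 2 : ℝ) : ℂ) + m).sqrt))))
    (bound := fun p : ℝ × ℝ => rexp (√(‖l‖ + c) * z) * rexp (-(z * √(p.1 ^ 2 + p.2 ^ 2))) *
      (z / (2 * c) + 1 / (2 * c * √c)))
    (Metric.ball_mem_nhds l hc)
    (.of_forall fun m => (measurable_decayKernel_comp z x y m).aestronglyMeasurable)
    ?_ ?_ ?_ ?_ ?_).2.differentiableAt
  · refine Integrable.mono' ((integrable_exp_neg_radial hz).const_mul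
      (rexp (√‖l‖ * z) / √c)) (measurable_decayKernel_comp z x y l).aestronglyMeasurable
      (.of_forall fun p => ?_)
    rw [norm_mul, norm_cexp_I_mul_ofReal, one_mul]
    refine (norm_decayKernel_le hz.le _ _).trans ?_
    rw [div_mul_eq_mul_div]
    gcongr
    exact (hball l hl').2 _ (hq p)
  · exact Measurable.aestronglyMeasurable (by fun_prop)
  · refine .of_forall fun p m hm => ?_
    rw [norm_mul, norm_cexp_I_mul_ofReal, one_mul]
    refine (norm_deriv_decayKernel_le hz.le hc _ _ ((hball m hm).2 _ (hq p))).trans ?_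
    gcongr
    exact hM m hm
  · exact ((integrable_exp_neg_radial hz).const_mul _).mul_const _
  · refine .of_forall fun p m hm => HasDerivAt.const_mul _ ?_
    exact (hasDerivAt_decayKernel z (add_mem_slitPlane (hq p) (hball m hm).1)).comp_const_add _ _

theorem Complex.sqrt_ofReal_of_nonneg {t : ℝ} (ht : 0 ≤ t) : (t : ℂ).sqrt = (√t : ℝ) := by
  rw [Complex.sqrt_of_nonneg (by exact_mod_cast ht), Complex.ofReal_re]

/-- Weyl's expansion with complex spectral parameter. -/
theorem weyl_slitPlane {z : ℝ} (hz : 0 < z) (x y : ℝ) {l : ℂ} (hl : l ∈ Complex.slitPlane) :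
    ∫ p : ℝ × ℝ, Complex.exp (Complex.I * ((p.1 * x + p.2 * y : ℝ) : ℂ)) *
      decayKernel z (((p.1 ^ 2 + p.2 ^ 2 : ℝ) : ℂ) + l) =
      2 * π * (Complex.exp (-(l.sqrt * (√(x ^ 2 + y ^ 2 + z ^ 2) : ℝ))) /
        (√(x ^ 2 + y ^ 2 + z ^ 2) : ℝ)) := by
  have h1 : AnalyticOnNhd ℂ (fun l : ℂ => ∫ p : ℝ × ℝ,
      Complex.exp (Complex.I * ((p.1 * x + p.2 * y : ℝ) : ℂ)) *
      decayKernel z (((p.1 ^ 2 + p.2 ^ 2 : ℝ) : ℂ) + l)) Complex.slitPlane :=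
    DifferentiableOn.analyticOnNhd (fun m hm =>
      (differentiableAt_integral_decayKernel hz x y hm).differentiableWithinAt)
      Complex.isOpen_slitPlane
  have h2 : AnalyticOnNhd ℂ (fun l : ℂ =>
      2 * (π : ℂ) * (Complex.exp (-(l.sqrt * (√(x ^ 2 + y ^ 2 + z ^ 2) : ℝ))) /
        (√(x ^ 2 + y ^ 2 + z ^ 2) : ℝ))) Complex.slitPlane := by
    refine DifferentiableOn.analyticOnNhd (fun m hm => ?_) Complex.isOpen_slitPlane
    have := Complex.differentiableAt_sqrt hm
    exact DifferentiableAt.differentiableWithinAt (by fun_prop)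
  refine h1.eqOn_of_preconnected_of_frequently_eq h2
    (Complex.starConvex_one_slitPlane.isPathConnected
      Complex.one_mem_slitPlane).isConnected.isPreconnected
    Complex.one_mem_slitPlane ?_ hl
  have hpos : ∀ t : ℝ, 0 < t → (∫ p : ℝ × ℝ,
      Complex.exp (Complex.I * ((p.1 * x + p.2 * y : ℝ) : ℂ)) *
      decayKernel z (((p.1 ^ 2 + p.2 ^ 2 : ℝ) : ℂ) + (t : ℂ))) =
      2 * (π : ℂ) * (Complex.exp (-((t : ℂ).sqrt * (√(x ^ 2 + y ^ 2 + z ^ 2) : ℝ))) /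
        (√(x ^ 2 + y ^ 2 + z ^ 2) : ℝ)) := by
    intro t ht
    have h := weyl_real (Real.sqrt_pos.2 ht) hz x y
    rw [Real.sq_sqrt ht.le] at h
    rw [Complex.sqrt_ofReal_of_nonneg ht.le]
    push_cast at h ⊢
    rw [← h]
    congr 1
    ext p
    have h3 : (p.1 : ℂ) ^ 2 + (p.2 : ℂ) ^ 2 + (t : ℂ) = ((p.1 ^ 2 + p.2 ^ 2 + t : ℝ) : ℂ) := by
      push_cast
      rfl
    rw [h3, decayKernel, Complex.sqrt_ofReal_of_nonneg (by positivity)]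
  have hmap : Filter.Tendsto (fun t : ℝ => (t : ℂ)) (nhdsWithin 1 {1}ᶜ) (nhdsWithin 1 {1}ᶜ) := by
    refine tendsto_nhdsWithin_iff.2 ⟨?_, ?_⟩
    · have := (Complex.continuous_ofReal.tendsto 1).mono_left (nhdsWithin_le_nhds (s := {(1 : ℝ)}ᶜ))
      simpa using this
    · filter_upwards [self_mem_nhdsWithin] with t ht
      simpa using ht
  refine hmap.frequently (Filter.Eventually.frequently ?_)
  filter_upwards [nhdsWithin_le_nhds (lt_mem_nhds (zero_lt_one' ℝ))] with t ht using hpos t ht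

open Filter Topology in
theorem Complex.tendsto_sqrt_sub_mul_I (v : ℝ) :
    Tendsto (fun e : ℝ => ((v : ℂ) - e * Complex.I).sqrt) (𝓝[>] 0)
      (𝓝 ((√((|v| + v) / 2) : ℝ) - (√((|v| - v) / 2) : ℝ) * Complex.I)) := by
  have hcont : Continuous fun e : ℝ =>
      (√((‖(v : ℂ) - e * Complex.I‖ + v) / 2) : ℂ) -
        (√((‖(v : ℂ) - e * Complex.I‖ - v) / 2) : ℂ) * Complex.I := by fun_prop
  have h := (hcont.tendsto 0).mono_left (nhdsWithin_le_nhds (s := Ioi (0 : ℝ)))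
  simp only [Complex.ofReal_zero, zero_mul, sub_zero, Complex.norm_real, Real.norm_eq_abs] at h
  refine h.congr' ?_
  filter_upwards [self_mem_nhdsWithin] with e he
  have he : 0 < e := he
  rw [Complex.sqrt_eq_real_add_ite, if_neg (by simpa using he)]
  simp
  ring

theorem kappaC_eq (k a b : ℝ) :
    kappaC k a b = Complex.I * ((√((|a ^ 2 + b ^ 2 - k ^ 2| + (a ^ 2 + b ^ 2 - k ^ 2)) / 2) : ℝ) -
      (√((|a ^ 2 + b ^ 2 - k ^ 2| - (a ^ 2 + b ^ 2 - k ^ 2)) / 2) : ℝ) * Complex.I) := by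
  unfold kappaC
  split_ifs with h
  · rw [abs_of_nonpos (by linarith)]
    have h1 : (-(a ^ 2 + b ^ 2 - k ^ 2) + (a ^ 2 + b ^ 2 - k ^ 2)) / 2 = 0 := by ring
    have h2 : (-(a ^ 2 + b ^ 2 - k ^ 2) - (a ^ 2 + b ^ 2 - k ^ 2)) / 2 = k ^ 2 - a ^ 2 - b ^ 2 := by
      ring
    rw [h1, h2, Real.sqrt_zero, Complex.ofReal_zero, zero_sub, mul_neg, mul_comm _ Complex.I,
      ← mul_assoc, Complex.I_mul_I, neg_one_mul, neg_neg]
  · push Not at h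
    rw [abs_of_pos (by linarith)]
    have h1 : (a ^ 2 + b ^ 2 - k ^ 2 - (a ^ 2 + b ^ 2 - k ^ 2)) / 2 = 0 := by ring
    rw [h1, Real.sqrt_zero, Complex.ofReal_zero, zero_mul, sub_zero, add_self_div_two]

theorem measurable_kappaC (k : ℝ) : Measurable fun p : ℝ × ℝ => kappaC k p.1 p.2 := by
  simp only [kappaC_eq]
  fun_prop

theorem norm_kappaC (k a b : ℝ) : ‖kappaC k a b‖ = √|a ^ 2 + b ^ 2 - k ^ 2| := by
  unfold kappaC
  split_ifs with h
  · rw [Complex.norm_real, Real.norm_of_nonneg (Real.sqrt_nonneg _), abs_of_nonpos (by linarith)]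
    ring_nf
  · push Not at h
    rw [norm_mul, Complex.norm_I, one_mul, Complex.norm_real,
      Real.norm_of_nonneg (Real.sqrt_nonneg _), abs_of_pos (by linarith)]

theorem sub_le_im_kappaC {k : ℝ} (hk : 0 ≤ k) (a b : ℝ) :
    √(a ^ 2 + b ^ 2) - k ≤ (kappaC k a b).im := by
  unfold kappaC
  split_ifs with h
  · rw [Complex.ofReal_im, sub_nonpos]
    exact Real.sqrt_le_iff.2 ⟨hk, h⟩
  · push Not at h
    simp only [Complex.mul_im, Complex.I_re, Complex.I_im, Complex.ofReal_re, Complex.ofReal_im,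
      zero_mul, one_mul, zero_add]
    rw [sub_le_iff_le_add]
    have h1 := Real.sq_sqrt (by linarith : 0 ≤ a ^ 2 + b ^ 2 - k ^ 2)
    refine Real.sqrt_le_iff.2 ⟨by positivity, ?_⟩
    nlinarith [mul_nonneg (Real.sqrt_nonneg (a ^ 2 + b ^ 2 - k ^ 2)) hk]

theorem norm_exp_I_kappaC_le {k : ℝ} (hk : 0 ≤ k) {z : ℝ} (hz : 0 ≤ z) (a b : ℝ) :
    ‖Complex.exp (Complex.I * (kappaC k a b * z))‖ ≤
      rexp (k * z) * rexp (-(z * √(a ^ 2 + b ^ 2))) := by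
  rw [Complex.norm_exp, ← Real.exp_add, Real.exp_le_exp]
  have h := mul_le_mul_of_nonneg_right (sub_le_im_kappaC hk a b) hz
  have h2 : (Complex.I * (kappaC k a b * z)).re = -((kappaC k a b).im * z) := by
    simp
  rw [h2]
  linarith

open Filter Topology in
/-- Weyl's plane-wave expansion of the outgoing spherical wave in the half space `0 < z`. -/
theorem weyl_identity {k z : ℝ} (hk : 0 < k) (hz : 0 < z) (x y : ℝ) :
    ∫ p : ℝ × ℝ, (kappaC k p.1 p.2)⁻¹ *
      Complex.exp (Complex.I * (((p.1 * x + p.2 * y : ℝ) : ℂ) + kappaC k p.1 p.2 * z)) =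
      -Complex.I * (2 * π * (Complex.exp (Complex.I * k * (√(x ^ 2 + y ^ 2 + z ^ 2) : ℝ)) /
        (√(x ^ 2 + y ^ 2 + z ^ 2) : ℝ))) := by
  have hslit : ∀ e : ℝ, 0 < e → ((-k ^ 2 : ℝ) : ℂ) - e * Complex.I ∈ Complex.slitPlane := by
    intro e he
    rw [Complex.mem_slitPlane_iff]
    right
    rw [Complex.sub_im, Complex.ofReal_im, Complex.im_ofReal_mul, Complex.I_im]
    simpa using he.ne'
  have hnorm : ∀ v e : ℝ, |v| ≤ ‖(v : ℂ) - e * Complex.I‖ := by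
    intro v e
    simpa using Complex.abs_re_le_norm ((v : ℂ) - e * Complex.I)
  have hL : Tendsto (fun e : ℝ => ∫ p : ℝ × ℝ,
      Complex.exp (Complex.I * ((p.1 * x + p.2 * y : ℝ) : ℂ)) *
      decayKernel z (((p.1 ^ 2 + p.2 ^ 2 : ℝ) : ℂ) + (((-k ^ 2 : ℝ) : ℂ) - e * Complex.I)))
      (𝓝[>] 0) (𝓝 (∫ p : ℝ × ℝ, Complex.I * ((kappaC k p.1 p.2)⁻¹ *
      Complex.exp (Complex.I * (((p.1 * x + p.2 * y : ℝ) : ℂ) + kappaC k p.1 p.2 * z))))) := by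
    refine tendsto_integral_filter_of_dominated_convergence
      (fun p : ℝ × ℝ => rexp (√(k ^ 2 + 1) * z) * (rexp (-(z * √(p.1 ^ 2 + p.2 ^ 2))) /
      √|p.1 ^ 2 + p.2 ^ 2 - k ^ 2|))
      (.of_forall fun e => (measurable_decayKernel_comp z x y _).aestronglyMeasurable) ?_
      ((integrable_exp_neg_radial_div_sqrt hz hk).const_mul _) ?_
    · filter_upwards [Ioo_mem_nhdsGT (zero_lt_one' ℝ)] with e he
      filter_upwards [ae_sq_add_sq_ne (k ^ 2)] with p hp
      have hp' : 0 < |p.1 ^ 2 + p.2 ^ 2 - k ^ 2| := abs_pos.2 (sub_ne_zero.2 hp)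
      rw [norm_mul, norm_cexp_I_mul_ofReal, one_mul]
      refine (norm_decayKernel_le hz.le _ _).trans ?_
      rw [mul_div_assoc]
      gcongr
      · refine (norm_sub_le _ _).trans ?_
        rw [Complex.norm_real, norm_mul, Complex.norm_I, Complex.norm_real, Real.norm_eq_abs,
          Real.norm_eq_abs, abs_of_pos he.1, abs_neg, abs_of_nonneg (sq_nonneg k)]
        linarith [he.2]
      · refine (hnorm _ e).trans (le_of_eq ?_)
        push_cast
        ring_nf
    · filter_upwards [ae_sq_add_sq_ne (k ^ 2)] with p hp
      have h1 := Complex.tendsto_sqrt_sub_mul_I (p.1 ^ 2 + p.2 ^ 2 - k ^ 2)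
      have hκ := kappaC_eq k p.1 p.2
      have hκ0 : kappaC k p.1 p.2 ≠ 0 := by
        rw [← norm_ne_zero_iff, norm_kappaC]
        exact (Real.sqrt_pos.2 (abs_pos.2 (sub_ne_zero.2 hp))).ne'
      generalize ((√((|p.1 ^ 2 + p.2 ^ 2 - k ^ 2| + (p.1 ^ 2 + p.2 ^ 2 - k ^ 2)) / 2) : ℝ) : ℂ) -
        (√((|p.1 ^ 2 + p.2 ^ 2 - k ^ 2| - (p.1 ^ 2 + p.2 ^ 2 - k ^ 2)) / 2) : ℝ) * Complex.I = S
        at h1 hκ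
      have hS : S ≠ 0 := by
        rintro rfl
        simp [hκ] at hκ0
      have h2 := (((h1.mul_const (z : ℂ)).neg.cexp).div h1 hS).const_mul
        (Complex.exp (Complex.I * ((p.1 * x + p.2 * y : ℝ) : ℂ)))
      have e1 : Complex.I * ((kappaC k p.1 p.2)⁻¹ *
          Complex.exp (Complex.I * (((p.1 * x + p.2 * y : ℝ) : ℂ) + kappaC k p.1 p.2 * z))) =
          Complex.exp (Complex.I * ((p.1 * x + p.2 * y : ℝ) : ℂ)) *
          (Complex.exp (-(S * z)) / S) := by
        have e2 : Complex.I * (((p.1 * x + p.2 * y : ℝ) : ℂ) + Complex.I * S * z) =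
            Complex.I * ((p.1 * x + p.2 * y : ℝ) : ℂ) + -(S * z) := by
          linear_combination S * z * Complex.I_mul_I
        rw [hκ, e2, Complex.exp_add]
        field_simp
      rw [e1]
      refine h2.congr fun e => ?_
      have e3 : ((p.1 ^ 2 + p.2 ^ 2 : ℝ) : ℂ) + (((-k ^ 2 : ℝ) : ℂ) - e * Complex.I) =
          ((p.1 ^ 2 + p.2 ^ 2 - k ^ 2 : ℝ) : ℂ) - e * Complex.I := by
        push_cast
        ring
      rw [e3]
      rfl
  have hR := Complex.tendsto_sqrt_sub_mul_I (-k ^ 2)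
  have hk2 : (|(-k ^ 2)| + -k ^ 2) / 2 = 0 := by
    rw [abs_neg, abs_of_nonneg (sq_nonneg k)]; ring
  have hk3 : (|(-k ^ 2)| - -k ^ 2) / 2 = k ^ 2 := by
    rw [abs_neg, abs_of_nonneg (sq_nonneg k)]; ring
  rw [hk2, hk3, Real.sqrt_sq hk.le, Real.sqrt_zero, Complex.ofReal_zero, zero_sub] at hR
  have hR2 := (((hR.mul_const ((√(x ^ 2 + y ^ 2 + z ^ 2) : ℝ) : ℂ)).neg.cexp).div_const
    ((√(x ^ 2 + y ^ 2 + z ^ 2) : ℝ) : ℂ)).const_mul (2 * π : ℂ)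
  have heq := tendsto_nhds_unique hL (hR2.congr' (by
    filter_upwards [self_mem_nhdsWithin] with e he
    exact (weyl_slitPlane hz x y (hslit e he)).symm))
  rw [integral_const_mul] at heq
  have h3 := congrArg (fun w => -Complex.I * w) heq
  simp only [← mul_assoc, neg_mul, Complex.I_mul_I, neg_neg, one_mul] at h3
  rw [h3]
  ring_nf

theorem integrable_of_support_subset_ball {f : ℝ × ℝ × ℝ → ℂ} (hf : Continuous f) {R : ℝ}
    (hR : 0 < R)
    (hsupp : Function.support f ⊆ {x : ℝ × ℝ × ℝ | x.1 ^ 2 + x.2.1 ^ 2 + x.2.2 ^ 2 < R ^ 2}) :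
    Integrable f := by
  refine hf.integrable_of_hasCompactSupport
    (HasCompactSupport.intro (isCompact_closedBall (0 : ℝ × ℝ × ℝ) R) fun x hx => ?_)
  by_contra hne
  have h : x.1 ^ 2 + x.2.1 ^ 2 + x.2.2 ^ 2 < R ^ 2 := hsupp hne
  refine hx ?_
  simp only [Metric.mem_closedBall, dist_zero_right, Prod.norm_def, Real.norm_eq_abs, sup_le_iff]
  refine ⟨abs_le_of_sq_le_sq ?_ hR.le, abs_le_of_sq_le_sq ?_ hR.le,
    abs_le_of_sq_le_sq ?_ hR.le⟩ <;>
  nlinarith [sq_nonneg x.1, sq_nonneg x.2.1, sq_nonneg x.2.2]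

/-- The contribution of the plane wave with transverse frequency `p` to the wave scattered
from the point `y` and observed at `(r1, r2, rM)`. -/
def planeWaveDensity (k0 r1 r2 rM : ℝ) (f : ℝ × ℝ × ℝ → ℂ) (y : ℝ × ℝ × ℝ) (p : ℝ × ℝ) : ℂ :=
  Complex.exp (Complex.I * ((k0 * y.2.2 : ℝ) : ℂ)) * f y *
    ((kappaC k0 p.1 p.2)⁻¹ * Complex.exp (Complex.I *
      (((p.1 * (r1 - y.1) + p.2 * (r2 - y.2.1) : ℝ) : ℂ) +
        kappaC k0 p.1 p.2 * ((rM - y.2.2 : ℝ) : ℂ))))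

theorem integrable_planeWaveDensity {k0 rs rM : ℝ} (hk0 : 0 < k0) (hrs : 0 < rs) (hrM : rs < rM)
    (r1 r2 : ℝ) {f : ℝ × ℝ × ℝ → ℂ} (hf : Continuous f)
    (hsupp : Function.support f ⊆
      {x : ℝ × ℝ × ℝ | x.1 ^ 2 + x.2.1 ^ 2 + x.2.2 ^ 2 < rs ^ 2}) :
    Integrable (Function.uncurry (planeWaveDensity k0 r1 r2 rM f)) (volume.prod volume) := by
  have hbound := (integrable_of_support_subset_ball hf hrs hsupp).norm.mul_prod
    ((integrable_exp_neg_radial_div_sqrt (sub_pos.2 hrM) hk0).const_mul (rexp (k0 * (rM + rs))))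
  refine Integrable.mono' hbound ?_ (.of_forall fun q => ?_)
  · have h1 := hf.measurable
    have h2 := (measurable_kappaC k0).comp
      (measurable_snd : Measurable (Prod.snd : (ℝ × ℝ × ℝ) × (ℝ × ℝ) → ℝ × ℝ))
    simp only [Function.comp_def] at h2
    refine Measurable.aestronglyMeasurable ?_
    unfold planeWaveDensity
    simp only [Function.uncurry_def]
    fun_prop
  · obtain ⟨y, p⟩ := q
    by_cases hy : f y = 0
    · simp [planeWaveDensity, hy]
    have hy2 : y.1 ^ 2 + y.2.1 ^ 2 + y.2.2 ^ 2 < rs ^ 2 := hsupp hy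
    have hy3 := abs_lt.1 (abs_lt_of_sq_lt_sq (a := y.2.2) (b := rs)
      (by nlinarith [sq_nonneg y.1, sq_nonneg y.2.1]) hrs.le)
    have hz : 0 ≤ rM - y.2.2 := by linarith
    simp only [Function.uncurry_apply_pair, planeWaveDensity]
    rw [norm_mul, norm_mul, norm_mul, norm_cexp_I_mul_ofReal, one_mul, norm_inv, norm_kappaC,
      mul_add, Complex.exp_add, norm_mul, norm_cexp_I_mul_ofReal, one_mul, div_eq_inv_mul,
      mul_left_comm (rexp _)]
    gcongr
    refine (norm_exp_I_kappaC_le hk0.le hz _ _).trans ?_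
    gcongr <;> linarith

theorem integral_planeWaveDensity_right {k0 rs rM : ℝ} (hk0 : 0 < k0) (hrs : 0 < rs)
    (hrM : rs < rM) (r1 r2 : ℝ) {f : ℝ × ℝ × ℝ → ℂ}
    (hsupp : Function.support f ⊆
      {x : ℝ × ℝ × ℝ | x.1 ^ 2 + x.2.1 ^ 2 + x.2.2 ^ 2 < rs ^ 2}) (y : ℝ × ℝ × ℝ) :
    ∫ p, planeWaveDensity k0 r1 r2 rM f y p = -(Complex.I * (8 * π ^ 2)) *
      (Complex.exp (Complex.I * (k0 : ℂ) *
        ((√((r1 - y.1) ^ 2 + (r2 - y.2.1) ^ 2 + (rM - y.2.2) ^ 2) : ℝ) : ℂ)) /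
      (4 * (π : ℂ) * ((√((r1 - y.1) ^ 2 + (r2 - y.2.1) ^ 2 + (rM - y.2.2) ^ 2) : ℝ) : ℂ)) *
      (Complex.exp (Complex.I * ((k0 * y.2.2 : ℝ) : ℂ)) * f y)) := by
  by_cases hy : f y = 0
  · simp [planeWaveDensity, hy]
  have hy2 : y.1 ^ 2 + y.2.1 ^ 2 + y.2.2 ^ 2 < rs ^ 2 := hsupp hy
  have hy3 := abs_lt.1 (abs_lt_of_sq_lt_sq (a := y.2.2) (b := rs)
    (by nlinarith [sq_nonneg y.1, sq_nonneg y.2.1]) hrs.le)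
  have hz : 0 < rM - y.2.2 := by linarith
  have hr : ((√((r1 - y.1) ^ 2 + (r2 - y.2.1) ^ 2 + (rM - y.2.2) ^ 2) : ℝ) : ℂ) ≠ 0 := by
    exact_mod_cast (Real.sqrt_pos.2 (by positivity)).ne'
  have hpi : (π : ℂ) ≠ 0 := by exact_mod_cast Real.pi_ne_zero
  unfold planeWaveDensity
  rw [integral_const_mul, weyl_identity hk0 hz]
  field_simp
  ring

theorem integral_planeWaveDensity_left (k0 r1 r2 rM : ℝ) (f : ℝ × ℝ × ℝ → ℂ) (p : ℝ × ℝ) :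
    (((2 * π) ^ (-(3 : ℝ) / 2) : ℝ) : ℂ) * ∫ y, planeWaveDensity k0 r1 r2 rM f y p =
      (kappaC k0 p.1 p.2)⁻¹ *
        Complex.exp (Complex.I *
          (((p.1 * r1 + p.2 * r2 : ℝ) : ℂ) + kappaC k0 p.1 p.2 * (rM : ℂ))) *
        FT3c f p.1 p.2 (kappaC k0 p.1 p.2 - (k0 : ℂ)) := by
  rw [FT3c, mul_left_comm (_ * _)]
  congr 1
  rw [← integral_const_mul]
  congr 1
  ext y
  have e : Complex.exp (Complex.I * ((k0 * y.2.2 : ℝ) : ℂ)) * Complex.exp (Complex.I *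
      (((p.1 * (r1 - y.1) + p.2 * (r2 - y.2.1) : ℝ) : ℂ) +
        kappaC k0 p.1 p.2 * ((rM - y.2.2 : ℝ) : ℂ))) =
      Complex.exp (Complex.I *
          (((p.1 * r1 + p.2 * r2 : ℝ) : ℂ) + kappaC k0 p.1 p.2 * (rM : ℂ))) *
      Complex.exp (-Complex.I * ((p.1 : ℂ) * (y.1 : ℂ) + (p.2 : ℂ) * (y.2.1 : ℂ) +
        (kappaC k0 p.1 p.2 - (k0 : ℂ)) * (y.2.2 : ℂ))) := by
    rw [← Complex.exp_add, ← Complex.exp_add]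
    congr 1
    push_cast
    ring
  unfold planeWaveDensity
  linear_combination (f y * (kappaC k0 p.1 p.2)⁻¹) * e

theorem rpow_neg_three_halves_mul_sqrt {t : ℝ} (ht : 0 < t) :
    t ^ (-(3 : ℝ) / 2) * √t * t = 1 := by
  rw [Real.sqrt_eq_rpow, ← Real.rpow_add ht, ← Real.rpow_add_one ht.ne']
  norm_num

end

theorem stmt18 (k0 rs rM : ℝ) (hk0 : 0 < k0) (hrs : 0 < rs) (hrM : rs < rM)
    (f : ℝ × ℝ × ℝ → ℂ) (hf : Continuous f)
    (hsupp : Function.support f ⊆ {x : ℝ × ℝ × ℝ | x.1 ^ 2 + x.2.1 ^ 2 + x.2.2 ^ 2 < rs ^ 2}) :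
    ∀ r1 r2 : ℝ,
      Integrable (fun p : ℝ × ℝ =>
        (kappaC k0 p.1 p.2)⁻¹ *
          Complex.exp (Complex.I *
            (((p.1 * r1 + p.2 * r2 : ℝ) : ℂ) + kappaC k0 p.1 p.2 * (rM : ℂ))) *
          FT3c f p.1 p.2 (kappaC k0 p.1 p.2 - (k0 : ℂ))) volume ∧
      uBorn k0 f (r1, r2, rM) =
        Complex.I / (2 * ((Real.sqrt (2 * Real.pi) : ℝ) : ℂ)) *
          ∫ p : ℝ × ℝ,
            (kappaC k0 p.1 p.2)⁻¹ *
              Complex.exp (Complex.I *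
                (((p.1 * r1 + p.2 * r2 : ℝ) : ℂ) + kappaC k0 p.1 p.2 * (rM : ℂ))) *
              FT3c f p.1 p.2 (kappaC k0 p.1 p.2 - (k0 : ℂ)) := by
  intro r1 r2
  have hint := integrable_planeWaveDensity hk0 hrs hrM r1 r2 hf hsupp
  simp only [← integral_planeWaveDensity_left]
  refine ⟨hint.integral_prod_right.const_mul _, ?_⟩
  have hswap := integral_integral_swap hint
  simp only [integral_planeWaveDensity_right hk0 hrs hrM r1 r2 hsupp] at hswap
  rw [integral_const_mul] at hswap ⊢
  rw [← hswap, uBorn]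
  have hc : (((2 * Real.pi) ^ (-(3 : ℝ) / 2) : ℝ) : ℂ) *
      ((Real.sqrt (2 * Real.pi) : ℝ) : ℂ) * (2 * Real.pi) = 1 := by
    exact_mod_cast rpow_neg_three_halves_mul_sqrt (t := 2 * Real.pi) (by positivity)
  have hs2 : ((Real.sqrt (2 * Real.pi) : ℝ) : ℂ) ^ 2 = 2 * Real.pi := by
    exact_mod_cast Real.sq_sqrt (by positivity : 0 ≤ 2 * Real.pi)
  have hs : ((Real.sqrt (2 * Real.pi) : ℝ) : ℂ) ≠ 0 := by
    exact_mod_cast (Real.sqrt_pos.2 (by positivity)).ne'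
  generalize (((2 * Real.pi) ^ (-(3 : ℝ) / 2) : ℝ) : ℂ) = A at *
  generalize ((Real.sqrt (2 * Real.pi) : ℝ) : ℂ) = s at *
  have key : Complex.I / (2 * s) * (A * -(Complex.I * (8 * Real.pi ^ 2))) = 1 := by
    have hpi : (Real.pi : ℂ) = s ^ 2 / 2 := by rw [hs2]; ring
    rw [hpi] at hc ⊢
    field_simp
    linear_combination 8 * hc - 8 * A * s ^ 3 * Complex.I_sq
  rw [← mul_assoc, ← mul_assoc, mul_assoc (Complex.I / (2 * s)), key, one_mul]
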